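/- arXiv:2005.06690 — 3 statements merged into one kernel-verified Lean document; each statement's English description precedes it below -/
import Mathlib

section
/- Let k be a field, 𝒜 a k-linear Hom-finite and Ext-finite abelian category, and let 0 → X → E → Y → 0 be an almost split short exact sequence with extension class η ∈ Ext¹(Y,X). Let γ ∈ D Ext¹(Y,X) be a k-linear functional with γ(η) ≠ 0. Then for every object M: (i) the k-linear map ψ_M: Hom(Y,M) → D Ext¹(M,X) sending g to the functional μ ↦ γ(g*μ) (where g*μ ∈ Ext¹(Y,X) is the pullback of μ along g) is surjective, and its kernel is exactly the set of projective morphisms Y → M; (ii) if μ ∈ Ext¹(M,X) satisfies γ(g*μ) = 0 for all g: Y → M, then μ = 0. -/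
/- Preliminary definitions: the abelian-category instance of the extriangulated
notions of the paper (s-projective/injective morphisms and objects, almost split
short exact sequences, morphisms determined by objects, etc.). -/

open CategoryTheory CategoryTheory.Limits

attribute [local instance] CategoryTheory.Abelian.hasFiniteBiproducts

universe w v u

variable {𝒜 : Type u} [Category.{v} 𝒜] [Abelian 𝒜]

section ExtDefs

variable [HasExt.{w} 𝒜]

/-- `f : X ⟶ Y` is a projective morphism if `Ext¹(f, A) : Ext¹(Y, A) → Ext¹(X, A)`
is zero for every object `A`. -/
def IsProjMorphism {X Y : 𝒜} (f : X ⟶ Y) : Prop :=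
  ∀ (A : 𝒜) (δ : Abelian.Ext Y A 1), (Abelian.Ext.mk₀ f).comp δ (zero_add 1) = 0

/-- `f : X ⟶ Y` is an injective morphism if `Ext¹(A, f) : Ext¹(A, X) → Ext¹(A, Y)`
is zero for every object `A`. -/
def IsInjMorphism {X Y : 𝒜} (f : X ⟶ Y) : Prop :=
  ∀ (A : 𝒜) (δ : Abelian.Ext A X 1), δ.comp (Abelian.Ext.mk₀ f) (add_zero 1) = 0

/-- An object `P` is (s-)projective when `Ext¹(P, A) = 0` for all `A`. -/
def IsExtProjective (P : 𝒜) : Prop := ∀ (A : 𝒜) (δ : Abelian.Ext P A 1), δ = 0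

/-- An object `I` is (s-)injective when `Ext¹(A, I) = 0` for all `A`. -/
def IsExtInjective (I : 𝒜) : Prop := ∀ (A : 𝒜) (δ : Abelian.Ext A I 1), δ = 0

/-- A short exact sequence `0 → X₁ → X₂ → X₃ → 0` with extension class `η` is
almost split if `η ≠ 0`, the pushout `a_*η` vanishes for every non-section
`a : X₁ ⟶ X'`, and the pullback `c^*η` vanishes for every non-retraction `c : Y' ⟶ X₃`. -/
def IsAlmostSplitSeq {S : ShortComplex 𝒜} (hS : S.ShortExact) : Prop :=
  hS.extClass ≠ 0 ∧
    (∀ (X' : 𝒜) (a : S.X₁ ⟶ X'), ¬ IsSplitMono a →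
      hS.extClass.comp (Abelian.Ext.mk₀ a) (add_zero 1) = 0) ∧
    (∀ (Y' : 𝒜) (c : Y' ⟶ S.X₃), ¬ IsSplitEpi c →
      (Abelian.Ext.mk₀ c).comp hS.extClass (zero_add 1) = 0)

/-- There exists an almost split short exact sequence `0 → A → E → B → 0`. -/
def ExistsAlmostSplitSeq (A B : 𝒜) : Prop :=
  ∃ (E : 𝒜) (i : A ⟶ E) (p : E ⟶ B) (w : i ≫ p = 0)
    (hS : (ShortComplex.mk i p w).ShortExact), IsAlmostSplitSeq hS

/-- There exists an almost split short exact sequence ending at `Y`. -/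
def ExistsAlmostSplitEndingAt (Y : 𝒜) : Prop := ∃ X : 𝒜, ExistsAlmostSplitSeq X Y

/-- There exists an almost split short exact sequence starting at `X`. -/
def ExistsAlmostSplitStartingAt (X : 𝒜) : Prop := ∃ Y : 𝒜, ExistsAlmostSplitSeq X Y

end ExtDefs

/-- `g` factors through `f` (both with target `Y`). -/
def FactorsThru {T X Y : 𝒜} (g : T ⟶ Y) (f : X ⟶ Y) : Prop := ∃ t : T ⟶ X, t ≫ f = g

/-- `f : X ⟶ Y` is right `C`-determined. -/
def RightDetermined (C : 𝒜) {X Y : 𝒜} (f : X ⟶ Y) : Prop :=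
  ∀ (T : 𝒜) (g : T ⟶ Y), (∀ h : C ⟶ T, FactorsThru (h ≫ g) f) → FactorsThru g f

/-- `Y` is a direct summand of `X`. -/
def IsDirectSummand (Y X : 𝒜) : Prop := ∃ (i : Y ⟶ X) (r : X ⟶ Y), i ≫ r = 𝟙 Y

/-- `X` is indecomposable: it is nonzero and in any biproduct decomposition one
of the factors vanishes. -/
def Indec (X : 𝒜) : Prop :=
  ¬ IsZero X ∧ ∀ (A B : 𝒜), Nonempty (X ≅ A ⊞ B) → IsZero A ∨ IsZero B

/-- `h : T ⟶ Z` lies in the radical: for every `u : Z ⟶ T` the composite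
`h ∘ u` lies in the Jacobson radical of `End Z`. -/
def InRadical {T Z : 𝒜} (h : T ⟶ Z) : Prop :=
  ∀ u : Z ⟶ T, (u ≫ h : End Z) ∈ (⊥ : Ideal (End Z)).jacobson

/-- `g : Z ⟶ Y` almost factors through `f : X ⟶ Y`. -/
def AlmostFactorsThru {Z X Y : 𝒜} (g : Z ⟶ Y) (f : X ⟶ Y) : Prop :=
  ¬ FactorsThru g f ∧ ∀ (T : 𝒜) (h : T ⟶ Z), InRadical h → FactorsThru (h ≫ g) f

/-- `y : B ⟶ C` is right almost split. -/
def RightAlmostSplit {B C : 𝒜} (y : B ⟶ C) : Prop :=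
  ¬ IsSplitEpi y ∧ ∀ (B' : 𝒜) (h : B' ⟶ C), ¬ IsSplitEpi h → FactorsThru h y

/-- `f : X ⟶ Y` is right minimal. -/
def RightMinimal {X Y : 𝒜} (f : X ⟶ Y) : Prop := ∀ g : X ⟶ X, g ≫ f = f → IsIso g

/-- A Krull–Schmidt category: every object is a finite biproduct of objects with
local endomorphism rings. -/
def IsKrullSchmidtCat (𝒞 : Type u) [Category.{v} 𝒞] [Abelian 𝒞] : Prop :=
  ∀ X : 𝒞, ∃ (n : ℕ) (Z : Fin n → 𝒞), Nonempty (X ≅ ⨁ Z) ∧ ∀ i, IsLocalRing (End (Z i))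

section LinearStructure

variable {k : Type*} [Field k] [CategoryTheory.Linear k 𝒜] [HasExt.{w} 𝒜]

lemma Ext_mk₀_add {X Y : 𝒜} (f g : X ⟶ Y) :
    Abelian.Ext.mk₀ (f + g) = Abelian.Ext.mk₀ f + Abelian.Ext.mk₀ g := by
  letI := HasDerivedCategory.standard 𝒜
  ext
  simp [ShiftedHom.mk₀, Abelian.Ext.add_hom]

/-- The `k`-module structure on the `Ext`-groups of a `k`-linear abelian category,
given by the composition with `r • 𝟙 X`. -/
noncomputable instance extModule (X Y : 𝒜) (n : ℕ) : Module k (Abelian.Ext X Y n) where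
  smul r e := (Abelian.Ext.mk₀ (r • 𝟙 X)).comp e (zero_add n)
  one_smul e := by
    show (Abelian.Ext.mk₀ ((1 : k) • 𝟙 X)).comp e (zero_add n) = e
    rw [one_smul, Abelian.Ext.mk₀_id_comp]
  mul_smul r s e := by
    show (Abelian.Ext.mk₀ ((r * s) • 𝟙 X)).comp e (zero_add n) =
      (Abelian.Ext.mk₀ (r • 𝟙 X)).comp
        ((Abelian.Ext.mk₀ (s • 𝟙 X)).comp e (zero_add n)) (zero_add n)
    rw [Abelian.Ext.mk₀_comp_mk₀_assoc]
    congr 2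
    rw [Linear.smul_comp, Linear.comp_smul, Category.comp_id, smul_smul]
  smul_zero r := by
    show (Abelian.Ext.mk₀ (r • 𝟙 X)).comp (0 : Abelian.Ext X Y n) (zero_add n) = 0
    exact Abelian.Ext.comp_zero _ Y n n (zero_add n)
  smul_add r e₁ e₂ := by
    show (Abelian.Ext.mk₀ (r • 𝟙 X)).comp (e₁ + e₂) (zero_add n) = _
    rw [Abelian.Ext.comp_add]; rfl
  add_smul r s e := by
    show (Abelian.Ext.mk₀ ((r + s) • 𝟙 X)).comp e (zero_add n) = _
    rw [add_smul, Ext_mk₀_add, Abelian.Ext.add_comp]; rfl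
  zero_smul e := by
    show (Abelian.Ext.mk₀ ((0 : k) • 𝟙 X)).comp e (zero_add n) = 0
    rw [zero_smul, Abelian.Ext.mk₀_zero, Abelian.Ext.zero_comp]

end LinearStructure

open Pretriangulated in
/-- Every class `μ` in `Ext¹(M, X)` is realized by some `X ⟶ E ⟶ M` which kills it and for which
the long exact sequences express the classes killed by pushout (resp. pullback) as pullbacks
(resp. pushouts) of `μ`. -/
lemma exists_realization_of_ext_one [HasExt.{w} 𝒜] {M X : 𝒜} (μ : Abelian.Ext M X 1) :
    ∃ (E : 𝒜) (a : X ⟶ E) (c : E ⟶ M),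
      μ.comp (Abelian.Ext.mk₀ a) (add_zero 1) = 0 ∧
      (Abelian.Ext.mk₀ c).comp μ (zero_add 1) = 0 ∧
      (∀ (Y : 𝒜) (η : Abelian.Ext Y X 1), η.comp (Abelian.Ext.mk₀ a) (add_zero 1) = 0 →
        ∃ g : Y ⟶ M, (Abelian.Ext.mk₀ g).comp μ (zero_add 1) = η) ∧
      (∀ (A : 𝒜) (ν : Abelian.Ext M A 1), (Abelian.Ext.mk₀ c).comp ν (zero_add 1) = 0 →
        ∃ h : X ⟶ A, μ.comp (Abelian.Ext.mk₀ h) (add_zero 1) = ν) := by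
  let := HasDerivedCategory.standard 𝒜
  let F := DerivedCategory.singleFunctor 𝒜 0
  let m : F.obj M ⟶ (F.obj X)⟦(1 : ℤ)⟧ := μ.hom
  obtain ⟨Z, f, g, hT⟩ := distinguished_cocone_triangle₂ m
  have hGE : Z.IsGE 0 := DerivedCategory.TStructure.t.isGE₂ _ hT 0
    (inferInstanceAs ((F.obj X).IsGE 0)) (inferInstanceAs ((F.obj M).IsGE 0))
  have hLE : Z.IsLE 0 := DerivedCategory.TStructure.t.isLE₂ _ hT 0
    (inferInstanceAs ((F.obj X).IsLE 0)) (inferInstanceAs ((F.obj M).IsLE 0))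
  obtain ⟨E, ⟨e⟩⟩ := DerivedCategory.exists_iso_singleFunctor_obj_of_isGE_of_isLE Z 0
  obtain ⟨a, ha⟩ := F.map_surjective (f ≫ e.hom)
  obtain ⟨c, hc⟩ := F.map_surjective (e.inv ≫ g)
  have hT' : Triangle.mk (F.map a) (F.map c) m ∈ distTriang (DerivedCategory 𝒜) :=
    isomorphic_distinguished _ hT _ (Triangle.isoMk _ _ (Iso.refl _) e.symm (Iso.refl _)
      (by
        change F.map a ≫ e.inv = 𝟙 _ ≫ f
        simp [ha])
      (by
        change F.map c ≫ 𝟙 _ = e.inv ≫ g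
        simp [hc])
      (by
        change m ≫ (shiftFunctor _ (1 : ℤ)).map (𝟙 (F.obj X)) = 𝟙 _ ≫ m
        simp))
  refine ⟨E, a, c, ?_, ?_, fun Y η hη ↦ ?_, fun A ν hν ↦ ?_⟩
  · ext
    rw [← Abelian.Ext.hom_comp_singleFunctor_map_shift, Abelian.Ext.zero_hom]
    exact comp_distTriang_mor_zero₃₁ _ hT'
  · ext
    rw [← Abelian.Ext.singleFunctor_map_comp_hom, Abelian.Ext.zero_hom]
    exact comp_distTriang_mor_zero₂₃ _ hT'
  · have h0 := congrArg Abelian.Ext.hom hη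
    rw [← Abelian.Ext.hom_comp_singleFunctor_map_shift, Abelian.Ext.zero_hom] at h0
    obtain ⟨t, ht⟩ := Triangle.coyoneda_exact₁ _ hT' η.hom h0
    obtain ⟨t, rfl⟩ := F.map_surjective t
    refine ⟨t, ?_⟩
    ext
    rw [← Abelian.Ext.singleFunctor_map_comp_hom]
    exact ht.symm
  · have h0 := congrArg Abelian.Ext.hom hν
    rw [← Abelian.Ext.singleFunctor_map_comp_hom, Abelian.Ext.zero_hom] at h0
    obtain ⟨t, ht⟩ := Triangle.yoneda_exact₃ _ hT' ν.hom h0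
    obtain ⟨t, rfl⟩ := (shiftFunctor (DerivedCategory 𝒜) (1 : ℤ)).map_surjective t
    obtain ⟨t, rfl⟩ := F.map_surjective t
    refine ⟨t, ?_⟩
    ext
    rw [← Abelian.Ext.hom_comp_singleFunctor_map_shift]
    exact ht.symm

/-- The class of an almost split sequence is a pullback of every nonzero class with the same
kernel. -/
lemma IsAlmostSplitSeq.exists_pullback_eq [HasExt.{w} 𝒜] {S : ShortComplex 𝒜}
    {hS : S.ShortExact} (hAS : IsAlmostSplitSeq hS) {M : 𝒜} {μ : Abelian.Ext M S.X₁ 1}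
    (hμ : μ ≠ 0) :
    ∃ g : S.X₃ ⟶ M, (Abelian.Ext.mk₀ g).comp μ (zero_add 1) = hS.extClass := by
  obtain ⟨E, a, -, ha, -, H, -⟩ := exists_realization_of_ext_one μ
  refine H _ _ (hAS.2.1 _ a fun hsplit ↦ hμ ?_)
  have := congrArg (fun x ↦ x.comp (Abelian.Ext.mk₀ (retraction a)) (add_zero 1)) ha
  simpa using this

/-- The class of an almost split sequence is a pushout of every nonzero class with the same
cokernel. -/
lemma IsAlmostSplitSeq.exists_pushout_eq [HasExt.{w} 𝒜] {S : ShortComplex 𝒜}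
    {hS : S.ShortExact} (hAS : IsAlmostSplitSeq hS) {A : 𝒜} {ν : Abelian.Ext S.X₃ A 1}
    (hν : ν ≠ 0) :
    ∃ h : A ⟶ S.X₁, ν.comp (Abelian.Ext.mk₀ h) (add_zero 1) = hS.extClass := by
  obtain ⟨E, -, c, -, hc, -, H⟩ := exists_realization_of_ext_one ν
  refine H _ _ (hAS.2.2 _ c fun hsplit ↦ hν ?_)
  have := congrArg (fun x ↦ (Abelian.Ext.mk₀ (section_ c)).comp x (zero_add 1)) hc
  simpa using this

/-- The pairing `(g, μ) ↦ γ (g^* μ)` between `Hom(Y, M)` and `Ext¹(M, X)` induced by a linear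
form `γ` on `Ext¹(Y, X)`. -/
noncomputable def extPairing {k : Type*} [Field k] [Linear k 𝒜] [HasExt.{w} 𝒜] {X Y : 𝒜}
    (γ : Abelian.Ext Y X 1 →ₗ[k] k) (M : 𝒜) :
    (Y ⟶ M) →ₗ[k] Abelian.Ext M X 1 →ₗ[k] k :=
  LinearMap.mk₂ k (fun g μ ↦ γ ((Abelian.Ext.mk₀ g).comp μ (zero_add 1)))
    (fun g g' μ ↦ by rw [Ext_mk₀_add, Abelian.Ext.add_comp, map_add])
    (fun r g μ ↦ by
      rw [← map_smul]
      congr 1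
      change _ = (Abelian.Ext.mk₀ (r • 𝟙 Y)).comp _ (zero_add 1)
      rw [Abelian.Ext.mk₀_comp_mk₀_assoc, Linear.smul_comp, Category.id_comp])
    (fun g μ μ' ↦ by rw [Abelian.Ext.comp_add, map_add])
    (fun r g μ ↦ by
      rw [← map_smul]
      congr 1
      change (Abelian.Ext.mk₀ g).comp ((Abelian.Ext.mk₀ (r • 𝟙 M)).comp μ (zero_add 1))
        (zero_add 1) = (Abelian.Ext.mk₀ (r • 𝟙 Y)).comp _ (zero_add 1)
      rw [Abelian.Ext.mk₀_comp_mk₀_assoc, Abelian.Ext.mk₀_comp_mk₀_assoc, Linear.smul_comp,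
        Linear.comp_smul, Category.id_comp, Category.comp_id])

/-- the defect formula for an almost split sequence,
contravariant version. -/
theorem statement_3 {k : Type*} [Field k] [Linear k 𝒜] [HasExt.{w} 𝒜]
    (homFin : ∀ A B : 𝒜, FiniteDimensional k (A ⟶ B))
    (extFin : ∀ A B : 𝒜, FiniteDimensional k (Abelian.Ext A B 1))
    {S : ShortComplex 𝒜} (hS : S.ShortExact) (hAS : IsAlmostSplitSeq hS)
    (γ : Abelian.Ext S.X₃ S.X₁ 1 →ₗ[k] k) (hγ : γ hS.extClass ≠ 0) (M : 𝒜) :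
    (∀ χ : Abelian.Ext M S.X₁ 1 →ₗ[k] k, ∃ g : S.X₃ ⟶ M,
        ∀ μ : Abelian.Ext M S.X₁ 1, γ ((Abelian.Ext.mk₀ g).comp μ (zero_add 1)) = χ μ) ∧
    (∀ g : S.X₃ ⟶ M,
        (∀ μ : Abelian.Ext M S.X₁ 1, γ ((Abelian.Ext.mk₀ g).comp μ (zero_add 1)) = 0)
          ↔ IsProjMorphism g) ∧
    (∀ μ : Abelian.Ext M S.X₁ 1,
        (∀ g : S.X₃ ⟶ M, γ ((Abelian.Ext.mk₀ g).comp μ (zero_add 1)) = 0) → μ = 0) := by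
  have nondeg : ∀ μ : Abelian.Ext M S.X₁ 1,
      (∀ g : S.X₃ ⟶ M, γ ((Abelian.Ext.mk₀ g).comp μ (zero_add 1)) = 0) → μ = 0 := by
    intro μ hμ
    by_contra hne
    obtain ⟨g, hg⟩ := hAS.exists_pullback_eq hne
    exact hγ (hg ▸ hμ g)
  refine ⟨fun χ ↦ ?_, fun g ↦ ⟨fun hg A δ ↦ ?_, fun hg μ ↦ by rw [hg, map_zero]⟩, nondeg⟩
  · have := extFin M S.X₁
    have hinj : Function.Injective (extPairing γ M).flip :=
      (injective_iff_map_eq_zero _).2 fun μ hμ ↦ nondeg μ fun g ↦ LinearMap.congr_fun hμ g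
    obtain ⟨g, hg⟩ := LinearMap.flip_injective_iff₂.1 hinj χ
    exact ⟨g, fun μ ↦ LinearMap.congr_fun hg μ⟩
  · by_contra hne
    obtain ⟨h, hh⟩ := hAS.exists_pushout_eq hne
    refine hγ ?_
    rw [← hh, Abelian.Ext.comp_assoc_of_third_deg_zero]
    exact hg _
end

section
/- Let k be a field, 𝒜 a k-linear Hom-finite, Ext-finite and Krull–Schmidt abelian category, and Y an indecomposable non-projective object. Then the following are equivalent: (1) there exist an object X and, for every object M, a surjective k-linear map φ_M: Hom(M,X) → D Ext¹(Y,M), natural in M, whose kernel is exactly the set of injective morphisms M → X (i.e. the functor D Ext¹(Y,−) is representable on the costable category, so Y lies in 𝒜_r); (2) there exists an almost split short exact sequence 0 → X' → E → Y → 0 ending at Y. -/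
/- Preliminary definitions: the abelian-category instance of the extriangulated
notions of the paper (s-projective/injective morphisms and objects, almost split
short exact sequences, morphisms determined by objects, etc.). -/

open CategoryTheory CategoryTheory.Limits

attribute [local instance] CategoryTheory.Abelian.hasFiniteBiproducts

universe w v u

variable {𝒜 : Type u} [Category.{v} 𝒜] [Abelian 𝒜]

section Realization

open DerivedCategory Pretriangulated in
/-- Short complexes whose image in the derived category completes to a distinguished triangle
are short exact. -/
lemma shortExact_of_distTriang [HasDerivedCategory 𝒜] {X E A : 𝒜} (i : X ⟶ E) (p : E ⟶ A)
    (δ : (singleFunctor 𝒜 0).obj A ⟶ ((singleFunctor 𝒜 0).obj X)⟦(1 : ℤ)⟧)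
    (hT : Triangle.mk ((singleFunctor 𝒜 0).map i) ((singleFunctor 𝒜 0).map p) δ ∈
      distTriang (DerivedCategory 𝒜)) :
    ∃ w : i ≫ p = 0, (ShortComplex.mk i p w).ShortExact := by
  have w : i ≫ p = 0 := (singleFunctor 𝒜 0).map_injective
    ((Functor.map_comp _ _ _).trans
      ((comp_distTriang_mor_zero₁₂ _ hT).trans ((singleFunctor 𝒜 0).map_zero X A).symm))
  have hi : Mono i := Preadditive.mono_of_cancel_zero _ fun {B} f hf => by
    have := TStructure.t.isGE_shift ((singleFunctor 𝒜 0).obj A) 0 (-1) 1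
    obtain ⟨g, hg⟩ := Triangle.coyoneda_exact₂ _ (inv_rot_of_distTriang _ hT)
      ((singleFunctor 𝒜 0).map f) (by
        change (singleFunctor 𝒜 0).map f ≫ (singleFunctor 𝒜 0).map i = 0
        rw [← Functor.map_comp, hf, Functor.map_zero])
    refine (singleFunctor 𝒜 0).map_injective (hg.trans ?_)
    have hg0 : g = 0 := TStructure.t.zero (Y := ((singleFunctor 𝒜 0).obj A)⟦(-1 : ℤ)⟧) g 0 1
    rw [hg0, zero_comp, Functor.map_zero]
    rfl
  have hp : Epi p := Preadditive.epi_of_cancel_zero _ fun {B} f hf => by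
    have := TStructure.t.isLE_shift ((singleFunctor 𝒜 0).obj X) 0 1 (-1)
    obtain ⟨g, hg⟩ := Triangle.yoneda_exact₃ _ hT ((singleFunctor 𝒜 0).map f) (by
        change (singleFunctor 𝒜 0).map p ≫ (singleFunctor 𝒜 0).map f = 0
        rw [← Functor.map_comp, hf, Functor.map_zero])
    refine (singleFunctor 𝒜 0).map_injective (hg.trans ?_)
    have hg0 : g = 0 := TStructure.t.zero (X := ((singleFunctor 𝒜 0).obj X)⟦(1 : ℤ)⟧) g (-1) 0
    rw [hg0, comp_zero, Functor.map_zero]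
    rfl
  refine ⟨w, ⟨(ShortComplex.exact_iff_exact_up_to_refinements _).2 fun {B} f hf => ?_⟩⟩
  obtain ⟨g, hg⟩ := Triangle.coyoneda_exact₂ _ hT ((singleFunctor 𝒜 0).map f)
    ((Functor.map_comp _ _ _).symm.trans ((congrArg _ hf).trans (Functor.map_zero _ _ _)))
  obtain ⟨g', rfl⟩ := (singleFunctor 𝒜 0).map_surjective (X := B) (Y := X) g
  refine ⟨B, 𝟙 B, inferInstance, g', (Category.id_comp _).trans ?_⟩
  exact (singleFunctor 𝒜 0).map_injective (hg.trans (Functor.map_comp _ _ _).symm)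

open DerivedCategory Pretriangulated in
/-- Every class in `Ext¹(A, X)` is the class of a short exact sequence. -/
lemma exists_extClass_eq [HasExt.{w} 𝒜] {A X : 𝒜} (ξ : Abelian.Ext A X 1) :
    ∃ (E : 𝒜) (i : X ⟶ E) (p : E ⟶ A) (w : i ≫ p = 0)
      (hS : (ShortComplex.mk i p w).ShortExact), hS.extClass = ξ := by
  let := HasDerivedCategory.standard 𝒜
  let δ : (singleFunctor 𝒜 0).obj A ⟶ ((singleFunctor 𝒜 0).obj X)⟦(1 : ℤ)⟧ := ξ.hom
  obtain ⟨K, f, g, hT⟩ := distinguished_cocone_triangle₂ δ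
  have : K.IsLE 0 := TStructure.t.isLE₂ _ hT 0
    (inferInstanceAs (((singleFunctor 𝒜 0).obj X).IsLE 0))
    (inferInstanceAs (((singleFunctor 𝒜 0).obj A).IsLE 0))
  have : K.IsGE 0 := TStructure.t.isGE₂ _ hT 0
    (inferInstanceAs (((singleFunctor 𝒜 0).obj X).IsGE 0))
    (inferInstanceAs (((singleFunctor 𝒜 0).obj A).IsGE 0))
  obtain ⟨E, ⟨e⟩⟩ := exists_iso_singleFunctor_obj_of_isGE_of_isLE K 0
  obtain ⟨i, hi⟩ := (singleFunctor 𝒜 0).map_surjective (f ≫ e.hom)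
  obtain ⟨p, hp⟩ := (singleFunctor 𝒜 0).map_surjective (e.inv ≫ g)
  have hT' : Triangle.mk ((singleFunctor 𝒜 0).map i) ((singleFunctor 𝒜 0).map p) δ ∈
      distTriang (DerivedCategory 𝒜) :=
    isomorphic_distinguished _ hT _ (Triangle.isoMk _ _ (Iso.refl _) e.symm (Iso.refl _)
      (by change (singleFunctor 𝒜 0).map i ≫ e.inv = 𝟙 _ ≫ f; simp [hi])
      (by change (singleFunctor 𝒜 0).map p ≫ 𝟙 _ = e.inv ≫ g; simp [hp])
      (by change δ ≫ (shiftFunctor _ (1 : ℤ)).map (𝟙 _) = 𝟙 _ ≫ δ; simp))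
  obtain ⟨w, hS⟩ := shortExact_of_distTriang i p δ hT'
  refine ⟨E, i, p, w, hS, ?_⟩
  obtain ⟨c, hc₁, hc₂⟩ := complete_distinguished_triangle_morphism _ _ hT'
    hS.singleTriangle_distinguished (𝟙 _) (𝟙 _)
      ((Category.comp_id _).trans (Category.id_comp _).symm)
  obtain ⟨c', rfl⟩ := (singleFunctor 𝒜 0).map_surjective (X := A) (Y := A) c
  have hc' : c' = 𝟙 A := by
    have := hS.epi_g
    have : Epi p := this
    rw [← cancel_epi p, Category.comp_id]
    refine (singleFunctor 𝒜 0).map_injective ?_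
    rw [Functor.map_comp]
    exact hc₁.trans (Category.id_comp _)
  subst hc'
  ext
  rw [hS.extClass_hom]
  change δ ≫ (shiftFunctor _ (1 : ℤ)).map (𝟙 _) =
    (singleFunctor 𝒜 0).map (𝟙 A) ≫ hS.singleδ at hc₂
  rw [CategoryTheory.Functor.map_id, CategoryTheory.Functor.map_id, Category.comp_id,
    Category.id_comp] at hc₂
  exact hc₂.symm

end Realization

section ExtOne

open Abelian

variable [HasExt.{w} 𝒜]

lemma not_isSplitMono_of_extClass_ne_zero {S : ShortComplex 𝒜} (hS : S.ShortExact)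
    (h : hS.extClass ≠ 0) : ¬ IsSplitMono S.f := fun _ => h <| by
  rw [← Ext.comp_mk₀_id hS.extClass, ← IsSplitMono.id S.f, ← Ext.mk₀_comp_mk₀,
    ← Ext.comp_assoc_of_second_deg_zero, hS.extClass_comp, Ext.zero_comp]

lemma not_isSplitEpi_of_extClass_ne_zero {S : ShortComplex 𝒜} (hS : S.ShortExact)
    (h : hS.extClass ≠ 0) : ¬ IsSplitEpi S.g := fun _ => h <| by
  rw [← Ext.mk₀_id_comp hS.extClass, ← IsSplitEpi.id S.g, ← Ext.mk₀_comp_mk₀_assoc,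
    hS.comp_extClass, Ext.comp_zero]

/-- If `η` is killed by pulling back along all non-retractions, it is a pushout of every
nonzero class. -/
lemma exists_comp_mk₀_eq {X Y M : 𝒜} {η : Ext Y X 1}
    (hη : ∀ (Y' : 𝒜) (c : Y' ⟶ Y), ¬ IsSplitEpi c → (Ext.mk₀ c).comp η (zero_add 1) = 0)
    {μ : Ext Y M 1} (hμ : μ ≠ 0) :
    ∃ f : M ⟶ X, μ.comp (Ext.mk₀ f) (add_zero 1) = η := by
  obtain ⟨E, i, p, w, hS, rfl⟩ := exists_extClass_eq μ
  obtain ⟨x, hx⟩ := Ext.contravariant_sequence_exact₃ hS X η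
    (hη _ _ (not_isSplitEpi_of_extClass_ne_zero hS hμ)) (add_zero 1)
  exact ⟨Ext.homEquiv₀ x, by rwa [Ext.mk₀_homEquiv₀_apply]⟩

/-- If `η` is killed by pushing out along all non-sections, it is a pullback of every
nonzero class. -/
lemma exists_mk₀_comp_eq {X Y A : 𝒜} {η : Ext Y X 1}
    (hη : ∀ (X' : 𝒜) (a : X ⟶ X'), ¬ IsSplitMono a → η.comp (Ext.mk₀ a) (add_zero 1) = 0)
    {ξ : Ext A X 1} (hξ : ξ ≠ 0) :
    ∃ c : Y ⟶ A, (Ext.mk₀ c).comp ξ (zero_add 1) = η := by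
  obtain ⟨E, i, p, w, hS, rfl⟩ := exists_extClass_eq ξ
  obtain ⟨x, hx⟩ := Ext.covariant_sequence_exact₁ Y hS η
    (hη _ _ (not_isSplitMono_of_extClass_ne_zero hS hξ)) (zero_add 1)
  exact ⟨Ext.homEquiv₀ x, by rwa [Ext.mk₀_homEquiv₀_apply]⟩

end ExtOne

section LocalEnd

lemma isIso_or_isIso_of_add_eq_id {X : 𝒜} [IsLocalRing (End X)] {f g : X ⟶ X}
    (h : f + g = 𝟙 X) : IsIso f ∨ IsIso g := by
  simpa only [isUnit_iff_isIso] using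
    IsLocalRing.isUnit_or_isUnit_of_add_one (R := End X) (a := f) (b := g) h

lemma Indec.isIso_of_isSplitMono {X Z : 𝒜} (hX : Indec X) (hZ : ¬ IsZero Z) (i : Z ⟶ X)
    [IsSplitMono i] : IsIso i := by
  let S := ShortComplex.mk i (cokernel.π i) (cokernel.condition i)
  have hS : S.Exact := ShortComplex.exact_cokernel i
  let s : S.Splitting := .ofExactOfRetraction S hS (retraction i) (IsSplitMono.id i)
    (inferInstanceAs (Epi (cokernel.π i)))
  have h0 := (hX.2 _ _ ⟨s.isoBinaryBiproduct⟩).resolve_left hZ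
  have : Epi i := Preadditive.epi_of_isZero_cokernel i h0
  exact isIso_of_mono_of_epi i

lemma Indec.isLocalRing_end (hKS : IsKrullSchmidtCat 𝒜) {X : 𝒜} (hX : Indec X) :
    ∃ (Z : 𝒜) (_ : X ≅ Z), IsLocalRing (End Z) := by
  obtain ⟨n, Z, ⟨e⟩, hZ⟩ := hKS X
  have hn : ∃ j : Fin n, True := by
    by_contra! h
    refine hX.1 (IsZero.of_iso ((IsZero.iff_id_eq_zero _).2 ?_) e)
    exact biproduct.hom_ext _ _ fun j => (h j).elim
  obtain ⟨j, -⟩ := hn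
  have := hZ j
  have hZj : ¬ IsZero (Z j) := fun h => one_ne_zero (α := End (Z j)) (h.eq_of_src _ _)
  have : IsSplitMono (biproduct.ι Z j ≫ e.inv) :=
    ⟨⟨⟨e.hom ≫ biproduct.π Z j, by simp⟩⟩⟩
  have := hX.isIso_of_isSplitMono hZj (biproduct.ι Z j ≫ e.inv)
  exact ⟨Z j, (asIso (biproduct.ι Z j ≫ e.inv)).symm, hZ j⟩

lemma Indec.isIso_or_isIso_of_add_eq_id (hKS : IsKrullSchmidtCat 𝒜) {X : 𝒜} (hX : Indec X)
    {f g : X ⟶ X} (h : f + g = 𝟙 X) : IsIso f ∨ IsIso g := by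
  obtain ⟨Z, e, hZ⟩ := hX.isLocalRing_end hKS
  have key : ∀ u : X ⟶ X, IsIso (e.inv ≫ u ≫ e.hom) → IsIso u := fun u hu => by
    simpa using (inferInstance : IsIso (e.hom ≫ (e.inv ≫ u ≫ e.hom) ≫ e.inv))
  exact (_root_.isIso_or_isIso_of_add_eq_id (f := e.inv ≫ f ≫ e.hom) (g := e.inv ≫ g ≫ e.hom)
    (by rw [← Preadditive.comp_add, ← Preadditive.add_comp, h]; simp)).imp (key f) (key g)

end LocalEnd

section AlmostSplit

open Abelian

variable [HasExt.{w} 𝒜]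

/-- A nonzero class killed by all non-retractions can be pushed out to one that moreover has
a first term with local endomorphism ring, in a Krull-Schmidt category. -/
lemma exists_summand_comp_ne_zero (hKS : IsKrullSchmidtCat 𝒜) {X Y : 𝒜} {η : Ext Y X 1}
    (hη : η ≠ 0) : ∃ (Z : 𝒜) (π : X ⟶ Z), IsLocalRing (End Z) ∧
      η.comp (Ext.mk₀ π) (add_zero 1) ≠ 0 := by
  obtain ⟨n, Z, ⟨e⟩, hZ⟩ := hKS X
  by_contra! h
  apply hη
  have hid : 𝟙 X = ∑ j, (e.hom ≫ biproduct.π Z j) ≫ (biproduct.ι Z j ≫ e.inv) := by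
    simp only [Category.assoc, ← Preadditive.comp_sum]
    simp only [← Category.assoc _ _ e.inv, ← Preadditive.sum_comp, biproduct.total]
    simp
  rw [← Ext.comp_mk₀_id η, hid, Ext.mk₀_sum, Ext.comp_sum]
  refine Finset.sum_eq_zero fun j _ => ?_
  rw [← Ext.mk₀_comp_mk₀, ← Ext.comp_assoc_of_second_deg_zero, h _ _ (hZ j), Ext.zero_comp]

/-- A nonzero class with local first term that is killed by all non-retractions is killed by
all non-sections. -/
lemma comp_mk₀_eq_zero_of_not_isSplitMono {X Y : 𝒜} [IsLocalRing (End X)] {η : Ext Y X 1}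
    (hη₀ : η ≠ 0)
    (hη : ∀ (Y' : 𝒜) (c : Y' ⟶ Y), ¬ IsSplitEpi c → (Ext.mk₀ c).comp η (zero_add 1) = 0)
    {X' : 𝒜} (a : X ⟶ X') (ha : ¬ IsSplitMono a) :
    η.comp (Ext.mk₀ a) (add_zero 1) = 0 := by
  by_contra h
  obtain ⟨b, hb⟩ := exists_comp_mk₀_eq hη h
  rw [Ext.comp_assoc_of_second_deg_zero, Ext.mk₀_comp_mk₀] at hb
  rcases isIso_or_isIso_of_add_eq_id (f := a ≫ b) (g := 𝟙 X - a ≫ b) (by abel) with h₁ | h₁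
  · exact ha ⟨⟨⟨b ≫ inv (a ≫ b), by rw [← Category.assoc, IsIso.hom_inv_id]⟩⟩⟩
  · apply hη₀
    have h0 : η.comp (Ext.mk₀ (𝟙 X - a ≫ b)) (add_zero 1) = 0 := by
      rw [sub_eq_add_neg, Ext.mk₀_add, Ext.mk₀_neg, Ext.comp_add, Ext.comp_neg, hb,
        Ext.comp_mk₀_id, add_neg_cancel]
    rw [← Ext.comp_mk₀_id η, ← IsIso.hom_inv_id (𝟙 X - a ≫ b), ← Ext.mk₀_comp_mk₀,
      ← Ext.comp_assoc_of_second_deg_zero, h0, Ext.zero_comp]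

/-- In a Krull-Schmidt category, a nonzero class killed by all non-retractions yields an almost
split sequence. -/
lemma existsAlmostSplitEndingAt_of_class (hKS : IsKrullSchmidtCat 𝒜) {X Y : 𝒜} {η : Ext Y X 1}
    (hη₀ : η ≠ 0)
    (hη : ∀ (Y' : 𝒜) (c : Y' ⟶ Y), ¬ IsSplitEpi c → (Ext.mk₀ c).comp η (zero_add 1) = 0) :
    ExistsAlmostSplitEndingAt Y := by
  obtain ⟨Z, π, hZ, hπ⟩ := exists_summand_comp_ne_zero hKS hη₀
  have hc : ∀ (Y' : 𝒜) (c : Y' ⟶ Y), ¬ IsSplitEpi c →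
      (Ext.mk₀ c).comp (η.comp (Ext.mk₀ π) (add_zero 1)) (zero_add 1) = 0 := fun Y' c h => by
    rw [← Ext.comp_assoc_of_third_deg_zero, hη _ c h, Ext.zero_comp]
  have ha := fun X' (a : Z ⟶ X') => comp_mk₀_eq_zero_of_not_isSplitMono hπ hc a
  obtain ⟨E, i, p, w, hS, hE⟩ := exists_extClass_eq (η.comp (Ext.mk₀ π) (add_zero 1))
  rw [← hE] at hπ hc ha
  exact ⟨Z, E, i, p, w, hS, hπ, ha, hc⟩

end AlmostSplit

section Linear

open Abelian

variable {k : Type*} [Field k] [Linear k 𝒜] [HasExt.{w} 𝒜]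

lemma ext_smul_def {X Y : 𝒜} {n : ℕ} (r : k) (e : Ext X Y n) :
    r • e = (Ext.mk₀ (r • 𝟙 X)).comp e (zero_add n) := rfl

lemma ext_smul_eq_comp_mk₀ {X Y : 𝒜} {n : ℕ} (r : k) (e : Ext X Y n) :
    r • e = e.comp (Ext.mk₀ (r • 𝟙 Y)) (add_zero n) := by
  rw [ext_smul_def, Ext.mk₀_smul, Ext.mk₀_smul, Ext.comp_smul, Ext.smul_comp,
    Ext.mk₀_id_comp, Ext.comp_mk₀_id]

/-- The pushout pairing `(f, μ) ↦ f_* μ`, as a bilinear map. -/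
noncomputable def extPushout (Y M X : 𝒜) : (M ⟶ X) →ₗ[k] Ext Y M 1 →ₗ[k] Ext Y X 1 :=
  LinearMap.mk₂ k (fun f μ => μ.comp (Ext.mk₀ f) (add_zero 1))
    (fun f g μ => by rw [Ext.mk₀_add, Ext.comp_add])
    (fun r f μ => by
      rw [ext_smul_eq_comp_mk₀, Ext.comp_assoc_of_second_deg_zero, Ext.mk₀_comp_mk₀,
        Linear.comp_smul, Category.comp_id])
    (fun f μ ν => by rw [Ext.add_comp])
    (fun r f μ => by rw [ext_smul_def, ext_smul_def, Ext.comp_assoc_of_third_deg_zero])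

/-- The pullback `c ↦ c^* η`, as a linear map. -/
noncomputable def extPullback {Y X : 𝒜} (A : 𝒜) (η : Ext Y X 1) : (A ⟶ Y) →ₗ[k] Ext A X 1 where
  toFun c := (Ext.mk₀ c).comp η (zero_add 1)
  map_add' c d := by rw [Ext.mk₀_add, Ext.add_comp]
  map_smul' r c := by
    rw [RingHom.id_apply, ext_smul_def, Ext.mk₀_comp_mk₀_assoc, Linear.smul_comp,
      Category.id_comp]

variable (k) in
/-- If `Y` has local endomorphism ring and `Ext¹(Y, X)` is nonzero and finite-dimensional, its
socle over `End Y` is nonzero. -/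
lemma exists_socle_class (extFin : ∀ A B : 𝒜, FiniteDimensional k (Ext A B 1))
    (hKS : IsKrullSchmidtCat 𝒜) {X Y : 𝒜} (hY : Indec Y) {η₀ : Ext Y X 1} (hη₀ : η₀ ≠ 0) :
    ∃ η : Ext Y X 1, η ≠ 0 ∧
      ∀ c : Y ⟶ Y, ¬ IsSplitEpi c → (Ext.mk₀ c).comp η (zero_add 1) = 0 := by
  let W (η : Ext Y X 1) : Submodule k (Ext Y X 1) := LinearMap.range (extPullback (k := k) Y η)
  obtain ⟨η, hη, hmin⟩ := exists_minimalFor_of_wellFoundedLT (fun η : Ext Y X 1 => η ≠ 0)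
    W ⟨η₀, hη₀⟩
  refine ⟨η, hη, fun c hc => by_contra fun h => ?_⟩
  have hle : W ((Ext.mk₀ c).comp η (zero_add 1)) ≤ W η := by
    rintro _ ⟨d, rfl⟩
    exact ⟨d ≫ c, (Ext.mk₀_comp_mk₀_assoc d c η).symm⟩
  obtain ⟨d, hd⟩ := hmin h hle ⟨𝟙 Y, Ext.mk₀_id_comp η⟩
  replace hd : (Ext.mk₀ (d ≫ c)).comp η (zero_add 1) = η :=
    (Ext.mk₀_comp_mk₀_assoc d c η).symm.trans hd
  rcases hY.isIso_or_isIso_of_add_eq_id hKS (f := d ≫ c) (g := 𝟙 Y - d ≫ c) (by abel)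
    with h₁ | h₁
  · exact hc ⟨⟨⟨inv (d ≫ c) ≫ d, by rw [Category.assoc, IsIso.inv_hom_id]⟩⟩⟩
  · apply hη
    have h0 : (Ext.mk₀ (𝟙 Y - d ≫ c)).comp η (zero_add 1) = 0 := by
      rw [sub_eq_add_neg, Ext.mk₀_add, Ext.mk₀_neg, Ext.add_comp, Ext.neg_comp, hd,
        Ext.mk₀_id_comp, add_neg_cancel]
    rw [← Ext.mk₀_id_comp η, ← IsIso.inv_hom_id (𝟙 Y - d ≫ c), ← Ext.mk₀_comp_mk₀_assoc, h0,
      Ext.comp_zero]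

/-- A bilinear pairing with trivial right kernel onto a finite-dimensional space represents
every linear form. -/
lemma LinearMap.surjective_of_separatingRight {V W : Type*} [AddCommGroup V] [Module k V]
    [AddCommGroup W] [Module k W] [FiniteDimensional k W] (B : V →ₗ[k] W →ₗ[k] k)
    (hB : ∀ y, y ≠ 0 → ∃ x, B x y ≠ 0) : Function.Surjective B := by
  rw [← LinearMap.flip_injective_iff₂, injective_iff_map_eq_zero]
  intro y hy
  by_contra h
  obtain ⟨x, hx⟩ := hB y h
  exact hx (LinearMap.congr_fun hy x)

end Linear


section Representability

open Abelian

variable {k : Type*} [Field k] [Linear k 𝒜] [HasExt.{w} 𝒜]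

/-- If `D Ext¹(Y, -)` is represented by `X` modulo injective morphisms, then every nonzero class
in `Ext¹(Y', X)` has a nonzero pullback along some morphism from `Y`. -/
lemma exists_mk₀_comp_ne_zero {X Y : 𝒜} (φ : ∀ M : 𝒜, (M ⟶ X) →ₗ[k] (Ext Y M 1 →ₗ[k] k))
    (hsurj : ∀ M : 𝒜, Function.Surjective (φ M))
    (hker : ∀ (M : 𝒜) (f : M ⟶ X), φ M f = 0 → IsInjMorphism f)
    (hnat : ∀ (M M' : 𝒜) (u : M' ⟶ M) (f : M ⟶ X) (μ' : Ext Y M' 1),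
      φ M' (u ≫ f) μ' = φ M f (μ'.comp (Ext.mk₀ u) (add_zero 1)))
    {Y' : 𝒜} {ξ : Ext Y' X 1} (hξ : ξ ≠ 0) :
    ∃ h : Y ⟶ Y', (Ext.mk₀ h).comp ξ (zero_add 1) ≠ 0 := by
  by_contra! H
  obtain ⟨B, i, p, w, hS, rfl⟩ := exists_extClass_eq ξ
  have hinj : LinearMap.ker (extPushout (k := k) Y X B i) = ⊥ := by
    refine (LinearMap.ker_eq_bot').2 fun μ hμ => ?_
    obtain ⟨x, hx⟩ := Ext.covariant_sequence_exact₁ Y hS μ hμ (zero_add 1)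
    rw [← hx, ← Ext.mk₀_homEquiv₀_apply x]
    exact H _
  obtain ⟨r, hr⟩ := LinearMap.exists_leftInverse_of_injective _ hinj
  obtain ⟨g, hg⟩ := hsurj B (φ X (𝟙 X) ∘ₗ r)
  have h0 : φ X (𝟙 X - i ≫ g) = 0 := by
    rw [map_sub, sub_eq_zero]
    ext μ
    rw [hnat, hg]
    exact congrArg (φ X (𝟙 X)) (LinearMap.congr_fun hr μ).symm
  have h1 := hker X _ h0 Y' hS.extClass
  apply hξ
  have h2 : hS.extClass.comp (Ext.mk₀ (i ≫ g)) (add_zero 1) = 0 := by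
    rw [← Ext.mk₀_comp_mk₀, ← Ext.comp_assoc_of_second_deg_zero]
    exact (congrArg (fun e : Ext Y' B 1 => e.comp (Ext.mk₀ g) (add_zero 1)) hS.extClass_comp).trans
      (Ext.zero_comp _ _ _ _ _)
  rw [sub_eq_add_neg, Ext.mk₀_add, Ext.mk₀_neg, Ext.comp_add, Ext.comp_neg, h2,
    Ext.comp_mk₀_id, neg_zero, add_zero] at h1
  exact h1

end Representability

/-- `Y ∈ 𝒜_r` iff there is an almost split sequence ending at `Y`. -/
theorem statement_5 {k : Type*} [Field k] [Linear k 𝒜] [HasExt.{w} 𝒜]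
    (homFin : ∀ A B : 𝒜, FiniteDimensional k (A ⟶ B))
    (extFin : ∀ A B : 𝒜, FiniteDimensional k (Abelian.Ext A B 1))
    (hKS : IsKrullSchmidtCat 𝒜)
    {Y : 𝒜} (hY : Indec Y) (hYnp : ¬ IsExtProjective Y) :
    (∃ (X : 𝒜) (φ : ∀ M : 𝒜, (M ⟶ X) →ₗ[k] (Abelian.Ext Y M 1 →ₗ[k] k)),
        (∀ M : 𝒜, Function.Surjective (φ M)) ∧
        (∀ (M : 𝒜) (f : M ⟶ X), φ M f = 0 ↔ IsInjMorphism f) ∧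
        (∀ (M M' : 𝒜) (u : M' ⟶ M) (f : M ⟶ X) (μ' : Abelian.Ext Y M' 1),
          φ M' (u ≫ f) μ' = φ M f (μ'.comp (Abelian.Ext.mk₀ u) (add_zero 1)))) ↔
      ExistsAlmostSplitEndingAt Y := by
  constructor
  · rintro ⟨X, φ, hsurj, hker, hnat⟩
    obtain ⟨A, δ, hδ⟩ : ∃ (A : 𝒜) (δ : Abelian.Ext Y A 1), δ ≠ 0 := by
      simpa [IsExtProjective] using hYnp
    obtain ⟨ψ, hψ⟩ : ∃ ψ : Abelian.Ext Y A 1 →ₗ[k] k, ψ δ ≠ 0 := by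
      by_contra! h
      exact hδ ((Module.forall_dual_apply_eq_zero_iff k δ).1 h)
    obtain ⟨f, rfl⟩ := hsurj A ψ
    have hη₀ : δ.comp (Abelian.Ext.mk₀ f) (add_zero 1) ≠ 0 := fun h => hψ <| by
      rw [← Category.comp_id f, hnat, h, map_zero]
    obtain ⟨η, hη, hηY⟩ := exists_socle_class k extFin hKS hY hη₀
    refine existsAlmostSplitEndingAt_of_class hKS hη fun Y' c hc => by_contra fun hξ => ?_
    obtain ⟨h, hh⟩ := exists_mk₀_comp_ne_zero φ hsurj (fun M f => (hker M f).1) hnat hξ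
    rw [Abelian.Ext.mk₀_comp_mk₀_assoc] at hh
    refine hh (hηY _ fun hs => hc ?_)
    exact ⟨⟨⟨section_ (h ≫ c) ≫ h, by rw [Category.assoc, IsSplitEpi.id]⟩⟩⟩
  · rintro ⟨X, E, i, p, w, hS, hη₀, hpush, hpull⟩
    change ∀ (X' : 𝒜) (a : X ⟶ X'), _ at hpush
    change ∀ (Y' : 𝒜) (c : Y' ⟶ Y), _ at hpull
    generalize hS.extClass = η at hη₀ hpush hpull
    change Abelian.Ext Y X 1 at η
    obtain ⟨γ, hγ⟩ : ∃ γ : Abelian.Ext Y X 1 →ₗ[k] k, γ η ≠ 0 := by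
      by_contra! h
      exact hη₀ ((Module.forall_dual_apply_eq_zero_iff k η).1 h)
    refine ⟨X, fun M => (extPushout Y M X).compr₂ γ, fun M => ?_, fun M f => ⟨fun hf A δ => ?_,
      fun hf => ?_⟩, fun M M' u f μ' => ?_⟩
    · have := extFin Y M
      refine LinearMap.surjective_of_separatingRight _ fun μ hμ => ?_
      obtain ⟨f, hf⟩ := exists_comp_mk₀_eq hpull hμ
      exact ⟨f, fun h => hγ (hf ▸ h)⟩
    · by_contra hδ
      obtain ⟨c, hc⟩ := exists_mk₀_comp_eq hpush hδ
      rw [← Abelian.Ext.comp_assoc_of_third_deg_zero] at hc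
      exact hγ (hc ▸ LinearMap.congr_fun hf _)
    · ext μ
      exact (congrArg γ (hf Y μ)).trans (map_zero γ)
    · change γ _ = γ _
      congr 1
      change μ'.comp (Abelian.Ext.mk₀ (u ≫ f)) (add_zero 1) =
        (μ'.comp (Abelian.Ext.mk₀ u) (add_zero 1)).comp (Abelian.Ext.mk₀ f) (add_zero 1)
      rw [Abelian.Ext.comp_assoc_of_second_deg_zero, Abelian.Ext.mk₀_comp_mk₀]
end

section
/- Let 𝒜 be a Krull–Schmidt abelian category, let 0 → L → X → a → Y → 0 be a short exact sequence (so a: X → Y is an epimorphism with kernel L), let C be an indecomposable object, and suppose f: C → Y almost factors through a. Then there exists an almost split short exact sequence 0 → K → E → C → 0 such that K is a direct summand of L. -/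
/- Preliminary definitions: the abelian-category instance of the extriangulated
notions of the paper (s-projective/injective morphisms and objects, almost split
short exact sequences, morphisms determined by objects, etc.). -/

open CategoryTheory CategoryTheory.Limits

attribute [local instance] CategoryTheory.Abelian.hasFiniteBiproducts

universe w v u

variable {𝒜 : Type u} [Category.{v} 𝒜] [Abelian 𝒜]

section Ring

variable {R : Type*} [Ring R] [IsLocalRing R]

/-- In a (not necessarily commutative) local ring, an element with a left inverse is a unit. -/
lemma IsLocalRing.isUnit_of_mul_eq_one_left {x y : R} (h : y * x = 1) : IsUnit x := by
  rcases IsLocalRing.isUnit_or_isUnit_of_add_one (add_sub_cancel (x * y) 1) with hu | hu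
  · obtain ⟨c, hc⟩ := hu.exists_right_inv
    have hidem : x * y * (x * y) = x * y := by
      rw [mul_assoc, ← mul_assoc y, h, one_mul]
    have hxy : x * y = 1 := by
      calc x * y = x * y * (x * y * c) := by rw [hc, mul_one]
        _ = x * y * c := by rw [← mul_assoc, hidem]
        _ = 1 := hc
    exact ⟨⟨x, y, hxy, h⟩, rfl⟩
  · have h0 : (1 - x * y) * x = 0 := by
      rw [sub_mul, one_mul, mul_assoc, h, mul_one, sub_self]
    have hx : x = 0 := (hu.mul_right_eq_zero).1 h0
    rw [hx, mul_zero] at h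
    exact absurd h zero_ne_one

/-- In a local ring, an element without left inverse lies in the Jacobson radical. -/
lemma IsLocalRing.mem_jacobson_bot_of_forall_mul_ne_one {x : R} (hx : ∀ y, y * x ≠ 1) :
    x ∈ (⊥ : Ideal R).jacobson := by
  rw [Ideal.mem_jacobson_iff]
  intro y
  rcases IsLocalRing.isUnit_or_isUnit_of_add_one (add_neg_cancel_right 1 (y * x)) with hu | hu
  · obtain ⟨z, hz⟩ := hu.exists_left_inv
    refine ⟨z, ?_⟩
    rw [Ideal.mem_bot, ← hz]
    noncomm_ring
  · obtain ⟨z, hz⟩ := hu.exists_left_inv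
    refine absurd ?_ (hx (-(z * y)))
    rw [← hz]
    noncomm_ring

end Ring

section KrullSchmidt

/-- An indecomposable object is isomorphic to each of its nonzero direct summands. -/
lemma Indec.nonempty_iso_of_isDirectSummand {C Z : 𝒜} (hC : Indec C) (hZ : ¬ IsZero Z)
    (h : IsDirectSummand Z C) : Nonempty (Z ≅ C) := by
  obtain ⟨i, r, hir⟩ := h
  have : Mono i := mono_of_mono_fac hir
  let S := ShortComplex.mk i (cokernel.π i) (cokernel.condition i)
  have hS : S.Exact := ShortComplex.exact_of_g_is_cokernel _ (cokernelIsCokernel i)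
  have : Epi S.g := inferInstanceAs (Epi (cokernel.π i))
  rcases hC.2 _ _ ⟨(ShortComplex.Splitting.ofExactOfRetraction S hS r hir
    inferInstance).isoBinaryBiproduct⟩ with h0 | h0
  · exact absurd h0 hZ
  · have : Epi i := Preadditive.epi_of_isZero_cokernel i h0
    have : IsIso i := isIso_of_mono_of_epi i
    exact ⟨asIso i⟩

/-- Having a local endomorphism ring is invariant under isomorphisms. -/
lemma isLocalRing_end_of_iso {Z C : 𝒜} (φ : Z ≅ C) [IsLocalRing (End Z)] :
    IsLocalRing (End C) where
  exists_pair_ne := (φ.conj : End Z ≃ End C).symm.nontrivial.exists_pair_ne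
  isUnit_or_isUnit_of_add_one {a b} h := by
    have h' : φ.symm.conj a + φ.symm.conj b = 1 := by
      have : φ.hom ≫ (a + b : C ⟶ C) ≫ φ.inv = 𝟙 Z := by
        rw [show (a + b : C ⟶ C) = 𝟙 C from h]
        simp
      rw [Preadditive.add_comp, Preadditive.comp_add] at this
      exact this
    rcases IsLocalRing.isUnit_or_isUnit_of_add_one h' with hu | hu
    · exact Or.inl ((MulEquiv.isUnit_map φ.symm.conj).1 hu)
    · exact Or.inr ((MulEquiv.isUnit_map φ.symm.conj).1 hu)

/-- In a Krull–Schmidt category, indecomposable objects have local endomorphism rings. -/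
lemma Indec.isLocalRing_end_s10 (hKS : IsKrullSchmidtCat 𝒜) {C : 𝒜} (hC : Indec C) :
    IsLocalRing (End C) := by
  obtain ⟨n, Z, ⟨e⟩, hZ⟩ := hKS C
  obtain ⟨j, hj⟩ : ∃ j, ¬ IsZero (Z j) := by
    by_contra! h
    refine hC.1 (((IsZero.iff_id_eq_zero _).2 ?_).of_iso e)
    exact biproduct.hom_ext _ _ fun j => (h j).eq_of_tgt _ _
  obtain ⟨φ⟩ := hC.nonempty_iso_of_isDirectSummand hj
    ⟨biproduct.ι Z j ≫ e.inv, e.hom ≫ biproduct.π Z j, by simp⟩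
  have := hZ j
  exact isLocalRing_end_of_iso φ

/-- If `C` has a local endomorphism ring, every non-retraction ending at `C` is radical. -/
lemma inRadical_of_not_isSplitEpi {T C : 𝒜} [IsLocalRing (End C)] {h : T ⟶ C}
    (hh : ¬ IsSplitEpi h) : InRadical h := by
  intro u
  let x : End C := u ≫ h
  have hu : ¬ IsUnit x := by
    intro hx
    obtain ⟨y, hy⟩ := hx.exists_right_inv
    exact hh ⟨⟨⟨y ≫ u, by rw [Category.assoc]; exact hy⟩⟩⟩
  exact IsLocalRing.mem_jacobson_bot_of_forall_mul_ne_one (x := x)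
    fun y hy => hu (IsLocalRing.isUnit_of_mul_eq_one_left hy)

end KrullSchmidt

section Extensions

open Abelian

variable [HasExt.{w} 𝒜]

/-- The pullback of an extension along `c` is represented by a short exact sequence. -/
lemma CategoryTheory.ShortComplex.ShortExact.exists_extClass_eq_mk₀_comp {S : ShortComplex 𝒜}
    (hS : S.ShortExact) {C : 𝒜} (c : C ⟶ S.X₃) :
    ∃ (E : 𝒜) (i : S.X₁ ⟶ E) (p : E ⟶ C) (w : i ≫ p = 0)
      (hS' : (ShortComplex.mk i p w).ShortExact),
      hS'.extClass = (Ext.mk₀ c).comp hS.extClass (zero_add 1) := by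
  have := hS.mono_f
  have := hS.epi_g
  let i : S.X₁ ⟶ pullback S.g c := pullback.lift S.f 0 (by simp)
  have hi : i ≫ pullback.fst S.g c = S.f := pullback.lift_fst _ _ _
  have w : i ≫ pullback.snd S.g c = 0 := pullback.lift_snd _ _ _
  have : Mono i := mono_of_mono_fac hi
  have hS' : (ShortComplex.mk i (pullback.snd S.g c) w).ShortExact :=
    { exact := ShortComplex.exact_of_f_is_kernel _ <| KernelFork.IsLimit.ofι' _ _ fun {A} k hk =>
        ⟨hS.exact.lift (k ≫ pullback.fst S.g c) (by
          rw [Category.assoc, pullback.condition, reassoc_of% hk, zero_comp]), by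
          ext
          · simp [hi]
          · simp [w, hk]⟩ }
  refine ⟨_, i, pullback.snd S.g c, w, hS', ?_⟩
  let φ : ShortComplex.mk i (pullback.snd S.g c) w ⟶ S :=
    { τ₁ := 𝟙 _
      τ₂ := pullback.fst S.g c
      τ₃ := c
      comm₁₂ := by simp [hi]
      comm₂₃ := pullback.condition }
  simpa [φ] using ShortComplex.ShortExact.extClass_naturality hS' hS φ

/-- The pushout of an extension along `b` is represented by a short exact sequence. -/
lemma CategoryTheory.ShortComplex.ShortExact.exists_extClass_eq_comp_mk₀ {S : ShortComplex 𝒜}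
    (hS : S.ShortExact) {K : 𝒜} (b : S.X₁ ⟶ K) :
    ∃ (E : 𝒜) (i : K ⟶ E) (p : E ⟶ S.X₃) (w : i ≫ p = 0)
      (hS' : (ShortComplex.mk i p w).ShortExact),
      hS'.extClass = hS.extClass.comp (Ext.mk₀ b) (add_zero 1) := by
  have := hS.mono_f
  have := hS.epi_g
  let p : pushout S.f b ⟶ S.X₃ := pushout.desc S.g 0 (by simp)
  have hp : pushout.inl S.f b ≫ p = S.g := pushout.inl_desc _ _ _
  have w : pushout.inr S.f b ≫ p = 0 := pushout.inr_desc _ _ _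
  have : Epi p := epi_of_epi_fac hp
  have hS' : (ShortComplex.mk (pushout.inr S.f b) p w).ShortExact :=
    { exact := ShortComplex.exact_of_g_is_cokernel _ <|
        CokernelCofork.IsColimit.ofπ' _ _ fun {A} k hk =>
          ⟨hS.exact.desc (pushout.inl S.f b ≫ k) (by
            rw [pushout.condition_assoc, hk, comp_zero]), by
            ext
            · simp [reassoc_of% hp]
            · simp [reassoc_of% w, hk]⟩ }
  refine ⟨_, pushout.inr S.f b, p, w, hS', ?_⟩
  let φ : S ⟶ ShortComplex.mk (pushout.inr S.f b) p w :=
    { τ₁ := b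
      τ₂ := pushout.inl S.f b
      τ₃ := 𝟙 _
      comm₁₂ := pushout.condition.symm
      comm₂₃ := by simp [hp] }
  simpa [φ] using (ShortComplex.ShortExact.extClass_naturality hS hS' φ).symm

/-- A nonzero extension class remains nonzero after pushing it out to one of the factors
of a finite biproduct decomposition. -/
lemma exists_comp_mk₀_π_ne_zero {C L : 𝒜} {n : ℕ} {Z : Fin n → 𝒜} (e : L ≅ ⨁ Z)
    {ξ : Ext.{w} C L 1} (hξ : ξ ≠ 0) :
    ∃ j, ξ.comp (Ext.mk₀ (e.hom ≫ biproduct.π Z j)) (add_zero 1) ≠ 0 := by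
  by_contra! h
  apply hξ
  have hid : 𝟙 L = ∑ j, (e.hom ≫ biproduct.π Z j) ≫ biproduct.ι Z j ≫ e.inv := by
    simp_rw [Category.assoc, ← Preadditive.comp_sum, ← Category.assoc (biproduct.π Z _),
      ← Preadditive.sum_comp, biproduct.total, Category.id_comp, e.hom_inv_id]
  have hmk : Ext.mk₀ (𝟙 L) =
      ∑ j, Ext.mk₀ ((e.hom ≫ biproduct.π Z j) ≫ biproduct.ι Z j ≫ e.inv) := by
    rw [hid, Ext.mk₀_sum]
  rw [← Ext.comp_mk₀_id ξ, hmk, Ext.comp_sum]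
  refine Finset.sum_eq_zero fun j _ => ?_
  rw [← Ext.mk₀_comp_mk₀, ← Ext.comp_assoc_of_third_deg_zero, h j, Ext.zero_comp]

/-- A nonsplit short exact sequence whose first term has a local endomorphism ring is almost
split as soon as its pullbacks along non-retractions vanish. -/
lemma isAlmostSplitSeq_of_isLocalRing {S : ShortComplex 𝒜} (hS : S.ShortExact)
    [IsLocalRing (End S.X₁)] (h0 : hS.extClass ≠ 0)
    (hpb : ∀ (Y' : 𝒜) (c : Y' ⟶ S.X₃), ¬ IsSplitEpi c →
      (Ext.mk₀ c).comp hS.extClass (zero_add 1) = 0) : IsAlmostSplitSeq hS := by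
  refine ⟨h0, fun X' a ha => ?_, hpb⟩
  by_contra hne
  obtain ⟨E, i, p, w, hS', hcl⟩ := hS.exists_extClass_eq_comp_mk₀ a
  have hp : ¬ IsSplitEpi p := fun hp => by
    apply hne
    rw [← hcl, ← Ext.mk₀_id_comp hS'.extClass, ← IsSplitEpi.id p, ← Ext.mk₀_comp_mk₀_assoc,
      hS'.comp_extClass, Ext.comp_zero]
  obtain ⟨x, hx⟩ := Ext.contravariant_sequence_exact₃ hS' _ hS.extClass (hpb _ p hp) (add_zero 1)
  obtain ⟨b, rfl⟩ := (Ext.mk₀_bijective _ _).2 x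
  rw [hcl, Ext.comp_assoc_of_third_deg_zero, Ext.mk₀_comp_mk₀] at hx
  let t : End S.X₁ := a ≫ b
  rcases IsLocalRing.isUnit_or_isUnit_of_add_one (add_sub_cancel t 1) with hu | hu
  · obtain ⟨y, hy⟩ := hu.exists_left_inv
    exact ha ⟨⟨⟨b ≫ y, by rw [← Category.assoc]; exact hy⟩⟩⟩
  · obtain ⟨y, hy⟩ := hu.exists_left_inv
    have hz : hS.extClass.comp (Ext.mk₀ (𝟙 S.X₁ - a ≫ b)) (add_zero 1) = 0 := by
      rw [sub_eq_add_neg, Ext.mk₀_add, Ext.mk₀_neg, Ext.comp_add, Ext.comp_neg, hx,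
        Ext.comp_mk₀_id, add_neg_cancel]
    apply h0
    have hy' : (𝟙 S.X₁ - a ≫ b) ≫ y = 𝟙 S.X₁ := hy
    rw [← Ext.comp_mk₀_id hS.extClass, ← hy', ← Ext.mk₀_comp_mk₀,
      ← Ext.comp_assoc_of_third_deg_zero, hz, Ext.zero_comp]

end Extensions

/-- a morphism almost factoring through a deflation yields an almost
split sequence whose first term is a direct summand of the kernel. -/
theorem statement_10 [HasExt.{w} 𝒜] (hKS : IsKrullSchmidtCat 𝒜)
    {L X Y C : 𝒜} (l : L ⟶ X) (a : X ⟶ Y) (w : l ≫ a = 0)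
    (hS : (ShortComplex.mk l a w).ShortExact)
    (hC : Indec C) (f : C ⟶ Y) (hf : AlmostFactorsThru f a) :
    ∃ (K E : 𝒜) (i : K ⟶ E) (p : E ⟶ C) (w' : i ≫ p = 0)
      (hS' : (ShortComplex.mk i p w').ShortExact),
      IsAlmostSplitSeq hS' ∧ IsDirectSummand K L := by
  have hCl := hC.isLocalRing_end_s10 hKS
  obtain ⟨n, Z, ⟨e⟩, hZ⟩ := hKS L
  have hξ : (Abelian.Ext.mk₀ f).comp hS.extClass (zero_add 1) ≠ 0 := fun h0 => by
    obtain ⟨x, hx⟩ := Abelian.Ext.covariant_sequence_exact₃ C hS (Abelian.Ext.mk₀ f) (zero_add 1) h0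
    obtain ⟨t, rfl⟩ := (Abelian.Ext.mk₀_bijective _ _).2 x
    rw [Abelian.Ext.mk₀_comp_mk₀] at hx
    exact hf.1 ⟨t, (Abelian.Ext.mk₀_bijective _ _).1 hx⟩
  obtain ⟨j, hj⟩ := exists_comp_mk₀_π_ne_zero e hξ
  obtain ⟨E₁, i₁, p₁, w₁, hS₁, hcl₁⟩ := hS.exists_extClass_eq_mk₀_comp f
  obtain ⟨E, i, p, w', hS', hcl⟩ := hS₁.exists_extClass_eq_comp_mk₀ (e.hom ≫ biproduct.π Z j)
  rw [hcl₁] at hcl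
  refine ⟨Z j, E, i, p, w', hS', ?_, biproduct.ι Z j ≫ e.inv, e.hom ≫ biproduct.π Z j, by simp⟩
  have : IsLocalRing (End (ShortComplex.mk i p w').X₁) := hZ j
  refine isAlmostSplitSeq_of_isLocalRing hS' (hcl ▸ hj) fun Y' c hc => ?_
  obtain ⟨t, ht⟩ := hf.2 _ c (inRadical_of_not_isSplitEpi hc)
  rw [hcl, ← Abelian.Ext.comp_assoc_of_third_deg_zero, Abelian.Ext.mk₀_comp_mk₀_assoc, ← ht,
    ← Abelian.Ext.mk₀_comp_mk₀_assoc, hS.comp_extClass, Abelian.Ext.comp_zero,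
    Abelian.Ext.zero_comp]
end
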